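/- For every integer n ≥ 3 and every vertex u ∈ V, the probability of the event E_{6,u} — that there exists a four-cycle rooted at u whose edge sequence pattern (writing s for a local edge and w for a long-range edge) is (s,w,w,w) or (w,w,w,s) — satisfies Pr(E_{6,u}) < (12·ζ(3) + 4) · (ln n + 1) · ln(n/2)^{−3}. -/

import Mathlib

open scoped Classical
open Finset

/-- Vertex set of the `n × n` torus. -/
abbrev Vx (n : ℕ) := Fin n × Fin n

/-- Toroidal distance on the `n × n` torus. -/
def tdist (n : ℕ) (u v : Vx n) : ℕ :=
  min ((u.1 : ℤ) - (v.1 : ℤ)).natAbs (n - ((u.1 : ℤ) - (v.1 : ℤ)).natAbs) +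
  min ((u.2 : ℤ) - (v.2 : ℤ)).natAbs (n - ((u.2 : ℤ) - (v.2 : ℤ)).natAbs)

/-- The normalizing factor at vertex `u`. -/
noncomputable def Zfac (n : ℕ) (u : Vx n) : ℝ :=
  (∑ w ∈ univ.filter (fun w => w ≠ u), ((tdist n u w : ℝ) ^ 2)⁻¹)⁻¹

/-- The probability mass of the outcome `c : V → V` (the vector of long-range choices)
under the UTSW product measure: each vertex `u` independently chooses `c u = v ≠ u`
with probability `Z · d(u,v)⁻²`. -/
noncomputable def mass (n : ℕ) (c : Vx n → Vx n) : ℝ :=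
  ∏ u : Vx n, if c u = u then 0 else Zfac n u * ((tdist n u (c u) : ℝ) ^ 2)⁻¹

/-- Probability of an event under the UTSW product measure. -/
noncomputable def Pr (n : ℕ) (E : Set (Vx n → Vx n)) : ℝ :=
  ∑ c : Vx n → Vx n, if c ∈ E then mass n c else 0

/-- `{x, y}` is an edge of the UTSW random graph `G(c)`. -/
def isEdge (n : ℕ) (c : Vx n → Vx n) (x y : Vx n) : Prop :=
  x ≠ y ∧ (tdist n x y = 1 ∨ c x = y ∨ c y = x)

/-- `{x, y}` is an edge of `G(c)` of the given kind: local (`w = false`, distance one)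
or long-range (`w = true`, distance not one). -/
def edgeKind (n : ℕ) (c : Vx n → Vx n) (x y : Vx n) (w : Bool) : Prop :=
  isEdge n c x y ∧ (tdist n x y = 1 ↔ w = false)

/-- There is a four-cycle rooted at `u` in `G(c)` whose edge sequence has the local/long-range
pattern `(p₁, p₂, p₃, p₄)` (`false` = local edge, `true` = long-range edge). -/
def cyclePat (n : ℕ) (c : Vx n → Vx n) (u : Vx n) (p₁ p₂ p₃ p₄ : Bool) : Prop :=
  ∃ a b e : Vx n, a ≠ b ∧ a ≠ e ∧ b ≠ e ∧ a ≠ u ∧ b ≠ u ∧ e ≠ u ∧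
    edgeKind n c u a p₁ ∧ edgeKind n c a b p₂ ∧ edgeKind n c b e p₃ ∧ edgeKind n c e u p₄

/-- `ζ(3) = ∑_{i ≥ 1} i⁻³`. -/
noncomputable def zeta3 : ℝ := ∑' i : ℕ, ((i + 1 : ℝ) ^ 3)⁻¹

/-- Distance on the cycle of length `n`. -/
def cdist (n : ℕ) (x y : Fin n) : ℕ :=
  min ((x : ℤ) - (y : ℤ)).natAbs (n - ((x : ℤ) - (y : ℤ)).natAbs)

lemma tdist_eq_cdist_add (n : ℕ) (u v : Vx n) :
    tdist n u v = cdist n u.1 v.1 + cdist n u.2 v.2 := rfl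

lemma cdist_comm (n : ℕ) (x y : Fin n) : cdist n x y = cdist n y x := by
  unfold cdist; omega

lemma cdist_triangle (n : ℕ) (x y z : Fin n) : cdist n x z ≤ cdist n x y + cdist n y z := by
  have := x.2; have := y.2; have := z.2
  unfold cdist; omega

lemma cdist_eq_zero {n : ℕ} {x y : Fin n} : cdist n x y = 0 ↔ y = x := by
  have := x.2; have := y.2
  rw [Fin.ext_iff]; unfold cdist; omega

lemma two_mul_cdist_le (n : ℕ) (x y : Fin n) : 2 * cdist n x y ≤ n := by
  have := x.2; have := y.2
  unfold cdist; omega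

lemma tdist_comm (n : ℕ) (u v : Vx n) : tdist n u v = tdist n v u := by
  simp only [tdist_eq_cdist_add, cdist_comm n u.1, cdist_comm n u.2]

lemma tdist_triangle (n : ℕ) (u v w : Vx n) : tdist n u w ≤ tdist n u v + tdist n v w := by
  have := cdist_triangle n u.1 v.1 w.1
  have := cdist_triangle n u.2 v.2 w.2
  simp only [tdist_eq_cdist_add]; omega

lemma tdist_eq_zero {n : ℕ} {u v : Vx n} : tdist n u v = 0 ↔ v = u := by
  rw [tdist_eq_cdist_add, Nat.add_eq_zero_iff, cdist_eq_zero, cdist_eq_zero, Prod.ext_iff]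

lemma tdist_le (n : ℕ) (u v : Vx n) : tdist n u v ≤ n := by
  have := two_mul_cdist_le n u.1 v.1
  have := two_mul_cdist_le n u.2 v.2
  rw [tdist_eq_cdist_add]; omega

/-- Number of integers of absolute value `j`. -/
def signCount (j : ℕ) : ℕ := if j = 0 then 1 else 2

lemma sum_antidiagonal_signCount {k : ℕ} (hk : 1 ≤ k) :
    ∑ p ∈ antidiagonal k, signCount p.1 * signCount p.2 = 4 * k := by
  obtain ⟨k, rfl⟩ := Nat.exists_eq_add_of_le' hk
  rw [Finset.Nat.sum_antidiagonal_eq_sum_range_succ_mk, Finset.sum_range_succ,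
    Finset.sum_range_succ']
  have h : ∀ i ∈ range k, signCount (i + 1) * signCount (k + 1 - (i + 1)) = 4 := by
    intro i hi
    rw [mem_range] at hi
    simp [signCount, Nat.sub_ne_zero_of_lt hi]
  rw [Finset.sum_congr rfl h]
  simp [signCount]
  ring

/-- The points at distance `j` from `x` on the cycle. -/
noncomputable def cycleSphere (n : ℕ) (x : Fin n) (j : ℕ) : Finset (Fin n) :=
  univ.filter fun y => cdist n x y = j

lemma mem_cycleSphere {n : ℕ} {x y : Fin n} {j : ℕ} :
    y ∈ cycleSphere n x j ↔ cdist n x y = j := by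
  simp [cycleSphere]

lemma exists_cycleSphere_eq_pair {n j : ℕ} (x : Fin n) (hj : 1 ≤ j) (hjn : 2 * j ≤ n) :
    ∃ p q : Fin n, cycleSphere n x j = {p, q} ∧ (2 * j < n → p ≠ q) := by
  have hx := x.2
  refine ⟨⟨if (x : ℕ) + j < n then x + j else x + j - n, by split_ifs <;> omega⟩,
    ⟨if j ≤ (x : ℕ) then x - j else x + n - j, by split_ifs <;> omega⟩, ?_, ?_⟩
  · ext y
    have := y.2
    simp only [mem_cycleSphere, mem_insert, mem_singleton, Fin.ext_iff, cdist]
    split_ifs <;> omega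
  · intro h
    simp only [ne_eq, Fin.ext_iff]
    split_ifs <;> omega

lemma card_cycleSphere_zero (n : ℕ) (x : Fin n) : (cycleSphere n x 0).card = 1 := by
  rw [card_eq_one]
  refine ⟨x, ?_⟩
  ext y
  simp [cycleSphere, cdist_eq_zero]

lemma card_cycleSphere_le (n : ℕ) (x : Fin n) (j : ℕ) :
    (cycleSphere n x j).card ≤ signCount j := by
  rcases Nat.eq_zero_or_pos j with rfl | hj
  · simp [card_cycleSphere_zero, signCount]
  · rw [signCount, if_neg hj.ne']
    by_cases hjn : 2 * j ≤ n
    · obtain ⟨p, q, h, -⟩ := exists_cycleSphere_eq_pair x hj hjn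
      rw [h]
      exact card_le_two
    · have : cycleSphere n x j = ∅ := by
        rw [cycleSphere, filter_eq_empty_iff]
        intro y _ hy
        have := two_mul_cdist_le n x y
        omega
      simp [this]

lemma card_cycleSphere {n j : ℕ} (x : Fin n) (hj : 2 * j < n) :
    (cycleSphere n x j).card = signCount j := by
  rcases Nat.eq_zero_or_pos j with rfl | hj'
  · simp [card_cycleSphere_zero, signCount]
  · obtain ⟨p, q, h, hpq⟩ := exists_cycleSphere_eq_pair x hj' hj.le
    rw [h, card_pair (hpq hj), signCount, if_neg hj'.ne']

/-- The points at distance `k` from `u` on the torus. -/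
noncomputable def torusSphere (n : ℕ) (u : Vx n) (k : ℕ) : Finset (Vx n) :=
  univ.filter fun w => tdist n u w = k

lemma mem_torusSphere {n : ℕ} {u w : Vx n} {k : ℕ} :
    w ∈ torusSphere n u k ↔ tdist n u w = k := by
  simp [torusSphere]

lemma card_torusSphere_eq_sum (n : ℕ) (u : Vx n) (k : ℕ) :
    (torusSphere n u k).card =
      ∑ p ∈ antidiagonal k, (cycleSphere n u.1 p.1).card * (cycleSphere n u.2 p.2).card := by
  have h : ∀ w ∈ torusSphere n u k, (cdist n u.1 w.1, cdist n u.2 w.2) ∈ antidiagonal k := by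
    intro w hw
    simpa [mem_torusSphere, tdist_eq_cdist_add] using hw
  rw [card_eq_sum_card_fiberwise h]
  refine Finset.sum_congr rfl fun p hp => ?_
  rw [← card_product]
  congr 1
  ext w
  rw [HasAntidiagonal.mem_antidiagonal] at hp
  simp only [mem_filter, mem_torusSphere, mem_cycleSphere, tdist_eq_cdist_add, mem_product,
    Prod.ext_iff]
  constructor
  · exact fun h => h.2
  · exact fun h => ⟨by rw [h.1, h.2, hp], h⟩

lemma card_torusSphere_le (n : ℕ) (u : Vx n) {k : ℕ} (hk : 1 ≤ k) :
    (torusSphere n u k).card ≤ 4 * k := by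
  rw [card_torusSphere_eq_sum, ← sum_antidiagonal_signCount hk]
  exact Finset.sum_le_sum fun p _ =>
    Nat.mul_le_mul (card_cycleSphere_le n _ _) (card_cycleSphere_le n _ _)

lemma card_torusSphere {n : ℕ} (u : Vx n) {k : ℕ} (hk : 1 ≤ k) (hkn : 2 * k < n) :
    (torusSphere n u k).card = 4 * k := by
  rw [card_torusSphere_eq_sum, ← sum_antidiagonal_signCount hk]
  refine Finset.sum_congr rfl fun p hp => ?_
  rw [HasAntidiagonal.mem_antidiagonal] at hp
  rw [card_cycleSphere _ (by omega), card_cycleSphere _ (by omega)]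

lemma sum_tdist_eq (n : ℕ) (u : Vx n) {g : ℕ → ℝ} (h0 : g 0 = 0) :
    ∑ w, g (tdist n u w) = ∑ k ∈ Icc 1 n, ((torusSphere n u k).card : ℝ) * g k := by
  have h : ∀ w ∈ (univ : Finset (Vx n)), tdist n u w ∈ range (n + 1) := fun w _ =>
    mem_range.2 (Nat.lt_succ_of_le (tdist_le n u w))
  rw [← sum_fiberwise_of_maps_to h]
  have h1 : ∀ k, ∑ w ∈ univ with tdist n u w = k, g (tdist n u w) =
      ((torusSphere n u k).card : ℝ) * g k := by
    intro k
    rw [Finset.sum_congr rfl (g := fun _ => g k)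
      (fun w hw => by rw [(mem_filter.1 hw).2]), sum_const, nsmul_eq_mul]
    rfl
  simp only [h1]
  rw [sum_range_succ', h0, mul_zero, add_zero, range_eq_Ico,
    Finset.sum_Ico_add' (fun k => ((torusSphere n u k).card : ℝ) * g k) 0 n 1]
  rfl

lemma sum_tdist_le (n : ℕ) (u : Vx n) {g : ℕ → ℝ} (h0 : g 0 = 0) (hg : ∀ k, 0 ≤ g k) :
    ∑ w, g (tdist n u w) ≤ ∑ k ∈ Icc 1 n, 4 * (k : ℝ) * g k := by
  rw [sum_tdist_eq n u h0]
  refine Finset.sum_le_sum fun k hk => mul_le_mul_of_nonneg_right ?_ (hg k)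
  exact_mod_cast card_torusSphere_le n u (mem_Icc.1 hk).1

lemma le_sum_tdist (n : ℕ) (u : Vx n) {g : ℕ → ℝ} (h0 : g 0 = 0) (hg : ∀ k, 0 ≤ g k) :
    ∑ k ∈ Icc 1 ((n - 1) / 2), 4 * (k : ℝ) * g k ≤ ∑ w, g (tdist n u w) := by
  rw [sum_tdist_eq n u h0]
  refine le_trans (Finset.sum_le_sum (g := fun k => ((torusSphere n u k).card : ℝ) * g k)
    fun k hk => ?_) (sum_le_sum_of_subset_of_nonneg (Icc_subset_Icc_right (by omega))
      fun k _ _ => mul_nonneg (Nat.cast_nonneg _) (hg k))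
  rw [mem_Icc] at hk
  rw [card_torusSphere u hk.1 (by omega)]
  push_cast
  rfl

/-- The inverse square of the toroidal distance, equal to `0` on the diagonal. -/
noncomputable def invSq (n : ℕ) (u v : Vx n) : ℝ := ((tdist n u v : ℝ) ^ 2)⁻¹

lemma invSq_nonneg (n : ℕ) (u v : Vx n) : 0 ≤ invSq n u v := by
  unfold invSq; positivity

lemma invSq_comm (n : ℕ) (u v : Vx n) : invSq n u v = invSq n v u := by
  rw [invSq, tdist_comm, invSq]

lemma invSq_self (n : ℕ) (u : Vx n) : invSq n u u = 0 := by
  simp [invSq, tdist_eq_zero.2 rfl]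

lemma sum_four_mul_inv_sq (m : ℕ) :
    ∑ k ∈ Icc 1 m, 4 * (k : ℝ) * ((k : ℝ) ^ 2)⁻¹ = 4 * (harmonic m : ℝ) := by
  rw [harmonic_eq_sum_Icc]
  push_cast
  rw [mul_sum]
  refine Finset.sum_congr rfl fun k hk => ?_
  have : (k : ℝ) ≠ 0 := by
    have := (mem_Icc.1 hk).1
    positivity
  field_simp

lemma sum_invSq_le (n : ℕ) (u : Vx n) : ∑ v, invSq n u v ≤ 4 * (Real.log n + 1) := by
  refine (sum_tdist_le n u (g := fun k => ((k : ℝ) ^ 2)⁻¹) (by simp)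
    (fun k => by positivity)).trans ?_
  rw [sum_four_mul_inv_sq]
  linarith [harmonic_le_one_add_log n]

lemma four_mul_log_le_sum_invSq {n : ℕ} (hn : 3 ≤ n) (u : Vx n) :
    4 * Real.log ((n : ℝ) / 2) ≤ ∑ v, invSq n u v := by
  refine le_trans ?_ (le_sum_tdist n u (g := fun k => ((k : ℝ) ^ 2)⁻¹) (by simp)
    (fun k => by positivity))
  rw [sum_four_mul_inv_sq]
  refine mul_le_mul_of_nonneg_left (le_trans ?_ (log_add_one_le_harmonic _)) (by norm_num)
  refine Real.log_le_log (by positivity) ?_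
  have : (n : ℝ) ≤ 2 * (((n - 1) / 2 + 1 : ℕ) : ℝ) := by
    have : n ≤ 2 * ((n - 1) / 2 + 1) := by omega
    exact_mod_cast this
  push_cast at this ⊢
  linarith

lemma log_half_pos {n : ℕ} (hn : 3 ≤ n) : 0 < Real.log ((n : ℝ) / 2) := by
  refine Real.log_pos ?_
  have : (3 : ℝ) ≤ n := by exact_mod_cast hn
  linarith

lemma sum_invSq_pos {n : ℕ} (hn : 3 ≤ n) (u : Vx n) : 0 < ∑ v, invSq n u v := by
  linarith [four_mul_log_le_sum_invSq hn u, log_half_pos hn]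

lemma Zfac_eq (n : ℕ) (u : Vx n) : Zfac n u = (∑ v, invSq n u v)⁻¹ := by
  rw [Zfac, sum_filter_of_ne (p := fun w => w ≠ u)]
  · rfl
  · rintro w - h rfl
    exact h (invSq_self n w)

/-- The probability that `u` chooses `v`. -/
noncomputable def linkProb (n : ℕ) (u v : Vx n) : ℝ := Zfac n u * invSq n u v

lemma linkProb_nonneg (n : ℕ) (u v : Vx n) : 0 ≤ linkProb n u v := by
  rw [linkProb, Zfac_eq]
  exact mul_nonneg (inv_nonneg.2 (sum_nonneg fun _ _ => invSq_nonneg _ _ _)) (invSq_nonneg _ _ _)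

lemma linkProb_le {n : ℕ} (hn : 3 ≤ n) (u v : Vx n) :
    linkProb n u v ≤ (4 * Real.log ((n : ℝ) / 2))⁻¹ * invSq n u v := by
  rw [linkProb, Zfac_eq]
  refine mul_le_mul_of_nonneg_right ?_ (invSq_nonneg _ _ _)
  exact inv_anti₀ (by linarith [log_half_pos hn]) (four_mul_log_le_sum_invSq hn u)

lemma sum_linkProb {n : ℕ} (hn : 3 ≤ n) (u : Vx n) : ∑ v, linkProb n u v = 1 := by
  simp only [linkProb]
  rw [← mul_sum, Zfac_eq]
  exact inv_mul_cancel₀ (sum_invSq_pos hn u).ne'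

lemma mass_eq_prod (n : ℕ) (c : Vx n → Vx n) : mass n c = ∏ u, linkProb n u (c u) := by
  refine Finset.prod_congr rfl fun u _ => ?_
  split_ifs with h
  · rw [linkProb, h, invSq_self, mul_zero]
  · rfl

lemma mass_nonneg (n : ℕ) (c : Vx n → Vx n) : 0 ≤ mass n c := by
  rw [mass_eq_prod]
  exact prod_nonneg fun _ _ => linkProb_nonneg _ _ _

lemma Pr_forall_mem_eq {n : ℕ} (hn : 3 ≤ n) (S : Finset (Vx n)) (t : Vx n → Vx n) :
    Pr n {c | ∀ s ∈ S, c s = t s} = ∏ s ∈ S, linkProb n s (t s) := by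
  have h : ∀ c : Vx n → Vx n, (if c ∈ {c | ∀ s ∈ S, c s = t s} then mass n c else 0) =
      ∏ u, if u ∈ S ∧ c u ≠ t u then 0 else linkProb n u (c u) := by
    intro c
    split_ifs with hc
    · rw [mass_eq_prod]
      refine Finset.prod_congr rfl fun u _ => ?_
      rw [if_neg]
      exact fun hu => hu.2 (hc u hu.1)
    · simp only [Set.mem_ofPred_eq, not_forall] at hc
      obtain ⟨s, hs, hne⟩ := hc
      refine (prod_eq_zero (mem_univ s) ?_).symm
      exact if_pos ⟨hs, hne⟩
  rw [Pr, Fintype.sum_congr _ _ fun c => by convert h c]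
  have h2 := (Finset.prod_univ_sum (fun _ : Vx n => (univ : Finset (Vx n)))
    (fun u v => if u ∈ S ∧ v ≠ t u then 0 else linkProb n u v)).symm
  rw [Fintype.piFinset_univ] at h2
  rw [h2, ← Finset.prod_subset (subset_univ S)
    (f := fun u => ∑ v, if u ∈ S ∧ v ≠ t u then 0 else linkProb n u v)]
  · refine Finset.prod_congr rfl fun u hu => ?_
    rw [Finset.sum_eq_single (t u)]
    · simp
    · intro v _ hv
      simp [hu, hv]
    · simp
  · intro u _ hu
    simp only [hu, false_and, if_false]
    exact sum_linkProb hn u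

lemma Pr_three_links_le {n : ℕ} (hn : 3 ≤ n) {s₁ s₂ s₃ : Vx n} (t₁ t₂ t₃ : Vx n)
    (h₁₂ : s₁ ≠ s₂) (h₁₃ : s₁ ≠ s₃) (h₂₃ : s₂ ≠ s₃) :
    Pr n {c | c s₁ = t₁ ∧ c s₂ = t₂ ∧ c s₃ = t₃} ≤
      (4 * Real.log ((n : ℝ) / 2))⁻¹ ^ 3 * (invSq n s₁ t₁ * invSq n s₂ t₂ * invSq n s₃ t₃) := by
  set K := (4 * Real.log ((n : ℝ) / 2))⁻¹
  have hset : {c : Vx n → Vx n | c s₁ = t₁ ∧ c s₂ = t₂ ∧ c s₃ = t₃} =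
      {c | ∀ s ∈ ({s₁, s₂, s₃} : Finset (Vx n)),
        c s = if s = s₁ then t₁ else if s = s₂ then t₂ else t₃} := by
    ext c
    simp [h₁₂.symm, h₁₃.symm, h₂₃.symm]
  rw [hset, Pr_forall_mem_eq hn, prod_insert (by simp [h₁₂, h₁₃]), prod_insert (by simp [h₂₃]),
    prod_singleton]
  simp only [if_true, h₁₂.symm, h₁₃.symm, h₂₃.symm, if_false]
  calc linkProb n s₁ t₁ * (linkProb n s₂ t₂ * linkProb n s₃ t₃)
      ≤ (K * invSq n s₁ t₁) * ((K * invSq n s₂ t₂) * (K * invSq n s₃ t₃)) := by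
        have h := fun s t => linkProb_nonneg n s t
        have h' := fun s t => linkProb_le hn s t
        have hK : ∀ s t, 0 ≤ K * invSq n s t := fun s t => (h s t).trans (h' s t)
        exact mul_le_mul (h' _ _) (mul_le_mul (h' _ _) (h' _ _) (h _ _) (hK _ _))
          (mul_nonneg (h _ _) (h _ _)) (hK _ _)
    _ = _ := by ring

lemma Pr_mono {n : ℕ} {E F : Set (Vx n → Vx n)} (h : E ⊆ F) : Pr n E ≤ Pr n F := by
  refine Finset.sum_le_sum fun c _ => ?_
  by_cases hc : c ∈ E
  · rw [if_pos hc, if_pos (h hc)]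
  · rw [if_neg hc]
    split_ifs
    exacts [mass_nonneg n c, le_rfl]

lemma Pr_union_le (n : ℕ) (E F : Set (Vx n → Vx n)) : Pr n (E ∪ F) ≤ Pr n E + Pr n F := by
  simp only [Pr]
  rw [← sum_add_distrib]
  refine Finset.sum_le_sum fun c _ => ?_
  have := mass_nonneg n c
  by_cases hE : c ∈ E <;> by_cases hF : c ∈ F <;> simp [hE, hF, this]

lemma Pr_biUnion_le (n : ℕ) {ι : Type*} (I : Finset ι) (A : ι → Set (Vx n → Vx n)) :
    Pr n (⋃ i ∈ I, A i) ≤ ∑ i ∈ I, Pr n (A i) := by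
  induction I using Finset.induction_on with
  | empty => simp [Pr]
  | insert i I hi ih =>
    rw [sum_insert hi, set_biUnion_insert]
    exact (Pr_union_le n _ _).trans (by linarith)

/-- The event that every edge of the path `a, b, e, u` is chosen by one of its two ends, with no
vertex choosing two of them. -/
def linkedPath (n : ℕ) (a b e u : Vx n) : Set (Vx n → Vx n) :=
  ({c | c a = b ∧ c b = e ∧ c e = u} ∪ {c | c a = b ∧ c b = e ∧ c u = e}) ∪
    ({c | c a = b ∧ c e = b ∧ c u = e} ∪ {c | c b = a ∧ c e = b ∧ c u = e})

lemma Pr_linkedPath_le {n : ℕ} (hn : 3 ≤ n) {a b e u : Vx n} (hab : a ≠ b) (hae : a ≠ e)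
    (hbe : b ≠ e) (hau : a ≠ u) (hbu : b ≠ u) (heu : e ≠ u) :
    Pr n (linkedPath n a b e u) ≤ 4 * (4 * Real.log ((n : ℝ) / 2))⁻¹ ^ 3 *
      (invSq n a b * invSq n b e * invSq n e u) := by
  have h₁ := Pr_three_links_le hn b e u hab hae hbe
  have h₂ := Pr_three_links_le hn b e e hab hau hbu
  have h₃ := Pr_three_links_le hn b b e hae hau heu
  have h₄ := Pr_three_links_le hn a b e hbe hbu heu
  rw [invSq_comm n u e] at h₂ h₃ h₄
  rw [invSq_comm n e b] at h₃ h₄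
  rw [invSq_comm n b a] at h₄
  have h₅ := Pr_union_le n {c | c a = b ∧ c b = e ∧ c e = u} {c | c a = b ∧ c b = e ∧ c u = e}
  have h₆ := Pr_union_le n {c | c a = b ∧ c e = b ∧ c u = e} {c | c b = a ∧ c e = b ∧ c u = e}
  have h₇ := Pr_union_le n
    ({c | c a = b ∧ c b = e ∧ c e = u} ∪ {c | c a = b ∧ c b = e ∧ c u = e})
    ({c | c a = b ∧ c e = b ∧ c u = e} ∪ {c | c b = a ∧ c e = b ∧ c u = e})
  rw [linkedPath]
  linarith

/-- The triples `(a, e, b)` which can complete `u` to a four-cycle of pattern `(s, w, w, w)`. -/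
noncomputable def cycleTriples (n : ℕ) (u : Vx n) : Finset (Vx n × Vx n × Vx n) :=
  univ.filter fun x => tdist n u x.1 = 1 ∧ 2 ≤ tdist n u x.2.1 ∧ x.1 ≠ x.2.1 ∧
    x.1 ≠ x.2.2 ∧ x.2.2 ≠ x.2.1 ∧ x.2.2 ≠ u

lemma edgeKind_comm {n : ℕ} {c : Vx n → Vx n} {x y : Vx n} {w : Bool} :
    edgeKind n c x y w ↔ edgeKind n c y x w := by
  unfold edgeKind isEdge
  rw [tdist_comm n x y, ne_comm, or_comm (a := c x = y)]

lemma cyclePat_reverse {n : ℕ} {c : Vx n → Vx n} {u : Vx n} {p₁ p₂ p₃ p₄ : Bool}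
    (h : cyclePat n c u p₁ p₂ p₃ p₄) : cyclePat n c u p₄ p₃ p₂ p₁ := by
  obtain ⟨a, b, e, hab, hae, hbe, hau, hbu, heu, h₁, h₂, h₃, h₄⟩ := h
  exact ⟨e, b, a, hbe.symm, hae.symm, hab.symm, heu, hbu, hau, edgeKind_comm.1 h₄,
    edgeKind_comm.1 h₃, edgeKind_comm.1 h₂, edgeKind_comm.1 h₁⟩

lemma edgeKind_true {n : ℕ} {c : Vx n → Vx n} {x y : Vx n} (h : edgeKind n c x y true) :
    tdist n x y ≠ 1 ∧ (c x = y ∨ c y = x) := by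
  obtain ⟨⟨-, h₁⟩, h₂⟩ := h
  have h₃ : tdist n x y ≠ 1 := fun h => by simpa using h₂.1 h
  exact ⟨h₃, h₁.resolve_left h₃⟩

lemma cyclePat_subset (n : ℕ) (u : Vx n) :
    {c | cyclePat n c u false true true true} ⊆
      ⋃ x ∈ cycleTriples n u, linkedPath n x.1 x.2.2 x.2.1 u := by
  rintro c ⟨a, b, e, hab, hae, hbe, hau, hbu, heu, h₁, h₂, h₃, h₄⟩
  simp only [Set.mem_iUnion]
  obtain ⟨-, h₂⟩ := edgeKind_true h₂
  obtain ⟨-, h₃⟩ := edgeKind_true h₃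
  obtain ⟨hd, h₄⟩ := edgeKind_true h₄
  rw [tdist_comm] at hd
  have hd0 : tdist n u e ≠ 0 := fun h => heu (tdist_eq_zero.1 h)
  refine ⟨(a, e, b), mem_filter.2 ⟨mem_univ _, h₁.2.2 rfl, ?_, hae, hab, hbe, hbu⟩, ?_⟩
  · show 2 ≤ tdist n u e
    omega
  · simp only [linkedPath, Set.mem_union, Set.mem_ofPred_eq]
    rcases h₂ with h₂ | h₂ <;> rcases h₃ with h₃ | h₃ <;> rcases h₄ with h₄ | h₄
    · exact Or.inl (Or.inl ⟨h₂, h₃, h₄⟩)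
    · exact Or.inl (Or.inr ⟨h₂, h₃, h₄⟩)
    · exact absurd (h₃.symm.trans h₄) hbu
    · exact Or.inr (Or.inl ⟨h₂, h₃, h₄⟩)
    · exact absurd (h₂.symm.trans h₃) hae
    · exact absurd (h₂.symm.trans h₃) hae
    · exact absurd (h₃.symm.trans h₄) hbu
    · exact Or.inr (Or.inr ⟨h₂, h₃, h₄⟩)

lemma invSq_mul_invSq_le {n : ℕ} {a e : Vx n} (hae : a ≠ e) (b : Vx n) :
    invSq n a b * invSq n b e ≤ 2 * invSq n a e * (invSq n a b + invSq n e b) := by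
  have hD : (0 : ℝ) < tdist n a e := by
    have : tdist n a e ≠ 0 := fun h => hae (tdist_eq_zero.1 h).symm
    positivity
  have hxy : (tdist n a e : ℝ) ≤ tdist n a b + tdist n b e := by
    exact_mod_cast tdist_triangle n a b e
  have hx : (0 : ℝ) ≤ tdist n a b := Nat.cast_nonneg _
  have hy : (0 : ℝ) ≤ tdist n b e := Nat.cast_nonneg _
  rw [invSq_comm n e b]
  unfold invSq
  generalize (tdist n a e : ℝ) = D at *
  generalize (tdist n a b : ℝ) = x at *
  generalize (tdist n b e : ℝ) = y at *
  rcases hx.eq_or_lt with rfl | hx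
  · simp; positivity
  rcases hy.eq_or_lt with rfl | hy
  · simp; positivity
  have h : 2 * (D ^ 2)⁻¹ * ((x ^ 2)⁻¹ + (y ^ 2)⁻¹) =
      2 * (x ^ 2 + y ^ 2) / D ^ 2 * ((x ^ 2)⁻¹ * (y ^ 2)⁻¹) := by
    field_simp
    ring
  rw [h]
  refine le_mul_of_one_le_left (by positivity) ?_
  rw [one_le_div (by positivity)]
  nlinarith [sq_nonneg (x - y)]

lemma sum_invSq_mul_invSq_le {n : ℕ} {a e : Vx n} (hae : a ≠ e) :
    ∑ b, invSq n a b * invSq n b e ≤ 16 * (Real.log n + 1) * invSq n a e := by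
  refine (Finset.sum_le_sum fun b _ => invSq_mul_invSq_le hae b).trans ?_
  rw [← mul_sum, sum_add_distrib]
  have := sum_invSq_le n a
  have := sum_invSq_le n e
  nlinarith [invSq_nonneg n a e]

/-- Partial sums of the series `ζ(3)`. -/
noncomputable def zeta3Partial (n : ℕ) : ℝ := ∑ k ∈ Icc 1 n, ((k : ℝ) ^ 3)⁻¹

lemma zeta3Partial_eq (n : ℕ) : zeta3Partial n = ∑ k ∈ range n, (((k : ℝ) + 1) ^ 3)⁻¹ := by
  rw [zeta3Partial, range_eq_Ico]
  have := Finset.sum_Ico_add' (fun k : ℕ => ((k : ℝ) ^ 3)⁻¹) 0 n 1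
  push_cast at this
  rw [this]
  rfl

lemma zeta3Partial_le_zeta3 (n : ℕ) : zeta3Partial n ≤ zeta3 := by
  rw [zeta3Partial_eq]
  refine Summable.sum_le_tsum _ (fun i _ => by positivity) ?_
  have := (summable_nat_add_iff 1).2 (Real.summable_nat_pow_inv.2 (by norm_num : 1 < 3))
  simpa using this

lemma zeta3Partial_le_two (n : ℕ) : zeta3Partial n ≤ 2 := by
  have h : ∀ m : ℕ, ∑ k ∈ range (m + 1), (((k : ℝ) + 1) ^ 3)⁻¹ ≤ 2 - 1 / ((m : ℝ) + 1) := by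
    intro m
    induction m with
    | zero => norm_num
    | succ m ih =>
      rw [sum_range_succ]
      have : (((m : ℝ) + 1 + 1) ^ 3)⁻¹ ≤ 1 / ((m : ℝ) + 1) - 1 / ((m : ℝ) + 1 + 1) := by
        rw [div_sub_div _ _ (by positivity) (by positivity), inv_eq_one_div,
          div_le_div_iff₀ (by positivity) (by positivity)]
        have : (0 : ℝ) ≤ m := Nat.cast_nonneg m
        nlinarith [pow_nonneg this 2, pow_nonneg this 3]
      push_cast
      linarith
  rw [zeta3Partial_eq]
  rcases n with _ | m
  · simp
  · have : 0 ≤ 1 / ((m : ℝ) + 1) := by positivity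
    linarith [h m]

lemma four_mul_inv_sq_sq {k : ℕ} (hk : 1 ≤ k) :
    4 * (k : ℝ) * (((k : ℝ) ^ 2)⁻¹) ^ 2 = 4 * ((k : ℝ) ^ 3)⁻¹ := by
  have : (k : ℝ) ≠ 0 := by positivity
  field_simp

lemma sum_sq_invSq_le (n : ℕ) (u : Vx n) : ∑ v, invSq n u v ^ 2 ≤ 4 * zeta3Partial n := by
  refine (sum_tdist_le n u (g := fun k => (((k : ℝ) ^ 2)⁻¹) ^ 2) (by simp)
    (fun k => by positivity)).trans_eq ?_
  rw [zeta3Partial, mul_sum]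
  exact Finset.sum_congr rfl fun k hk => four_mul_inv_sq_sq (mem_Icc.1 hk).1

lemma sum_sq_invSq_far_le {n : ℕ} (hn : 1 ≤ n) (u : Vx n) :
    ∑ v ∈ univ.filter (fun v => 2 ≤ tdist n u v), invSq n u v ^ 2 ≤
      4 * zeta3Partial n - 4 := by
  rw [sum_filter]
  refine (sum_tdist_le n u (g := fun k => if 2 ≤ k then (((k : ℝ) ^ 2)⁻¹) ^ 2 else 0) (by simp)
    (fun k => by split_ifs <;> positivity)).trans_eq ?_
  rw [zeta3Partial, ← add_sum_Ioc_eq_sum_Icc hn, ← add_sum_Ioc_eq_sum_Icc hn, mul_add, mul_sum]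
  have : ∀ k ∈ Ioc 1 n, 4 * (k : ℝ) * (if 2 ≤ k then (((k : ℝ) ^ 2)⁻¹) ^ 2 else 0) =
      4 * ((k : ℝ) ^ 3)⁻¹ := by
    intro k hk
    have := (mem_Ioc.1 hk).1
    rw [if_pos (by omega), four_mul_inv_sq_sq (by omega)]
  rw [Finset.sum_congr rfl this]
  norm_num

lemma sum_far_invSq_mul_invSq_le {n : ℕ} (hn : 1 ≤ n) (a u : Vx n) :
    ∑ e ∈ univ.filter (fun e => 2 ≤ tdist n u e), invSq n a e * invSq n e u ≤
      4 * zeta3Partial n - 2 := by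
  have h : ∀ e ∈ univ.filter (fun e => 2 ≤ tdist n u e), invSq n a e * invSq n e u ≤
      (invSq n a e ^ 2 + invSq n u e ^ 2) / 2 := by
    intro e _
    rw [invSq_comm n e u]
    nlinarith [sq_nonneg (invSq n a e - invSq n u e)]
  refine (Finset.sum_le_sum h).trans ?_
  rw [← sum_div, sum_add_distrib]
  have h₁ := sum_sq_invSq_far_le hn u
  have h₂ : ∑ e ∈ univ.filter (fun e => 2 ≤ tdist n u e), invSq n a e ^ 2 ≤
      ∑ e, invSq n a e ^ 2 :=
    sum_le_sum_of_subset_of_nonneg (filter_subset _ _) fun _ _ _ => sq_nonneg _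
  linarith [sum_sq_invSq_le n a]

lemma sum_cycleTriples_le {n : ℕ} (hn : 1 ≤ n) (u : Vx n) :
    ∑ x ∈ cycleTriples n u, invSq n x.1 x.2.2 * invSq n x.2.2 x.2.1 * invSq n x.2.1 u ≤
      64 * (Real.log n + 1) * (4 * zeta3Partial n - 2) := by
  have hL : 0 ≤ 16 * (Real.log n + 1) := by
    have := Real.log_natCast_nonneg n
    positivity
  have hf : ∀ a b e : Vx n, 0 ≤ invSq n a b * invSq n b e * invSq n e u := fun a b e =>
    mul_nonneg (mul_nonneg (invSq_nonneg _ _ _) (invSq_nonneg _ _ _)) (invSq_nonneg _ _ _)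
  have hsphere : ((torusSphere n u 1).card : ℝ) ≤ 4 := by
    exact_mod_cast card_torusSphere_le n u le_rfl
  have hb : ∀ a e : Vx n, (∑ b, if a ≠ e then invSq n a b * invSq n b e * invSq n e u else 0) ≤
      16 * (Real.log n + 1) * (invSq n a e * invSq n e u) := by
    intro a e
    by_cases hae : a = e
    · simp [hae, invSq_self]
    · simp only [ne_eq, hae, not_false_eq_true, if_true]
      rw [← sum_mul, ← mul_assoc]
      exact mul_le_mul_of_nonneg_right (sum_invSq_mul_invSq_le hae) (invSq_nonneg _ _ _)
  have hpos : 0 ≤ 4 * zeta3Partial n - 2 :=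
    (sum_nonneg fun e _ => mul_nonneg (invSq_nonneg _ _ _) (invSq_nonneg _ _ _)).trans
      (sum_far_invSq_mul_invSq_le hn u u)
  calc ∑ x ∈ cycleTriples n u, invSq n x.1 x.2.2 * invSq n x.2.2 x.2.1 * invSq n x.2.1 u
      = ∑ x ∈ cycleTriples n u, if x.1 ≠ x.2.1 then
          invSq n x.1 x.2.2 * invSq n x.2.2 x.2.1 * invSq n x.2.1 u else 0 := by
        refine Finset.sum_congr rfl fun x hx => (if_pos ?_).symm
        exact (mem_filter.1 hx).2.2.2.1
    _ ≤ ∑ x ∈ torusSphere n u 1 ×ˢ (univ.filter (fun e => 2 ≤ tdist n u e) ×ˢ univ),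
          if x.1 ≠ x.2.1 then
            invSq n x.1 x.2.2 * invSq n x.2.2 x.2.1 * invSq n x.2.1 u else 0 := by
        refine sum_le_sum_of_subset_of_nonneg (fun x hx => ?_) fun x _ _ => ?_
        · have := (mem_filter.1 hx).2
          simp [mem_torusSphere, this.1, this.2.1]
        · split_ifs
          exacts [hf _ _ _, le_rfl]
    _ = ∑ a ∈ torusSphere n u 1, ∑ e ∈ univ.filter (fun e => 2 ≤ tdist n u e), ∑ b,
          if a ≠ e then invSq n a b * invSq n b e * invSq n e u else 0 := by
        simp only [sum_product]
    _ ≤ ∑ a ∈ torusSphere n u 1, 16 * (Real.log n + 1) * (4 * zeta3Partial n - 2) := by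
        refine Finset.sum_le_sum fun a _ => (Finset.sum_le_sum fun e _ => hb a e).trans ?_
        rw [← mul_sum]
        exact mul_le_mul_of_nonneg_left (sum_far_invSq_mul_invSq_le hn a u) hL
    _ ≤ 4 * (16 * (Real.log n + 1) * (4 * zeta3Partial n - 2)) := by
        rw [sum_const, nsmul_eq_mul]
        exact mul_le_mul_of_nonneg_right hsphere (mul_nonneg hL hpos)
    _ = 64 * (Real.log n + 1) * (4 * zeta3Partial n - 2) := by ring

/-- Probability bound for the event `E6ᵤ`. -/
theorem prob_E6 :
    ∀ n : ℕ, 3 ≤ n → ∀ u : Vx n,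
      Pr n {c | cyclePat n c u false true true true ∨ cyclePat n c u true true true false} <
        (12 * zeta3 + 4) * (Real.log (n : ℝ) + 1) * (Real.log ((n : ℝ) / 2) ^ 3)⁻¹ := by
  intro n hn u
  have hlog := log_half_pos hn
  set K := (Real.log ((n : ℝ) / 2) ^ 3)⁻¹ with hK
  have hKpos : 0 < K := by positivity
  have hL : 0 < Real.log n + 1 := by
    have := Real.log_natCast_nonneg n
    positivity
  have hsub : {c | cyclePat n c u false true true true ∨ cyclePat n c u true true true false} ⊆
      ⋃ x ∈ cycleTriples n u, linkedPath n x.1 x.2.2 x.2.1 u := by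
    rintro c (hc | hc)
    exacts [cyclePat_subset n u hc, cyclePat_subset n u (cyclePat_reverse hc)]
  have hne : ∀ {v : Vx n} {d : ℕ}, tdist n u v = d → d ≠ 0 → v ≠ u := fun h hd hv =>
    hd (h ▸ tdist_eq_zero.2 hv)
  have hpath : ∀ x ∈ cycleTriples n u, Pr n (linkedPath n x.1 x.2.2 x.2.1 u) ≤
      K / 16 * (invSq n x.1 x.2.2 * invSq n x.2.2 x.2.1 * invSq n x.2.1 u) := by
    intro x hx
    obtain ⟨-, h₁, h₂, hae, hab, hbe, hbu⟩ := mem_filter.1 hx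
    refine (Pr_linkedPath_le hn hab hae hbe (hne h₁ one_ne_zero) hbu
      (hne rfl (by omega))).trans_eq ?_
    rw [hK, mul_inv, mul_pow, ← inv_pow]
    ring
  calc _ ≤ ∑ x ∈ cycleTriples n u, Pr n (linkedPath n x.1 x.2.2 x.2.1 u) :=
        (Pr_mono hsub).trans (Pr_biUnion_le n _ _)
    _ ≤ K / 16 * ∑ x ∈ cycleTriples n u,
          invSq n x.1 x.2.2 * invSq n x.2.2 x.2.1 * invSq n x.2.1 u := by
        rw [mul_sum]
        exact Finset.sum_le_sum hpath
    _ ≤ K / 16 * (64 * (Real.log n + 1) * (4 * zeta3Partial n - 2)) :=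
        mul_le_mul_of_nonneg_left (sum_cycleTriples_le (by omega) u) (by positivity)
    _ = (16 * zeta3Partial n - 8) * ((Real.log n + 1) * K) := by ring
    _ < (12 * zeta3 + 4) * ((Real.log n + 1) * K) := by
        refine mul_lt_mul_of_pos_right ?_ (mul_pos hL hKpos)
        linarith [zeta3Partial_le_zeta3 n, zeta3Partial_le_two n]
    _ = _ := by ring
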